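/- Let d ≥ 2, 1 < p < ∞, and j, k ∈ {1,…,d} with j ≠ k. Suppose M ≥ 0 is such that ‖R_dis^{(jk)} f‖_{ℓ^p(ℤ^d)} ≤ M ‖f‖_{ℓ^p(ℤ^d)} for all f ∈ ℓ^p(ℤ^d). Then for every smooth compactly supported F : ℝ^d → ℝ, the principal value R^{(jk)}F(x) = lim_{r→0⁺} c_d ∫_{|y|>r} y_j y_k |y|^{−(d+2)} F(x − y) dy exists for every x and ‖R^{(jk)}F‖_{L^p(ℝ^d)} ≤ M ‖F‖_{L^p(ℝ^d)}. Analogously, if M' ≥ 0 satisfies ‖(R_dis^{(jj)} − R_dis^{(kk)}) f‖_{ℓ^p} ≤ M' ‖f‖_{ℓ^p} for all f ∈ ℓ^p(ℤ^d), then ‖(R^{(jj)} − R^{(kk)})F‖_{L^p(ℝ^d)} ≤ M' ‖F‖_{L^p(ℝ^d)} for every smooth compactly supported F. -/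

import Mathlib

open MeasureTheory Real Filter

noncomputable section

/-- The lattice ℤ^d. -/
abbrev ZLat (d : ℕ) := Fin d → ℤ

/-- Embedding of the lattice ℤ^d into Euclidean space ℝ^d. -/
def latVec {d : ℕ} (m : ZLat d) : EuclideanSpace ℝ (Fin d) := WithLp.toLp 2 (fun i => (m i : ℝ))

/-- The (Gaussian) heat kernel on ℝ^d. -/
def heatK (d : ℕ) (t : ℝ) (x : EuclideanSpace ℝ (Fin d)) : ℝ :=
  (2 * π * t) ^ (-(d : ℝ) / 2) * Real.exp (-‖x‖ ^ 2 / (2 * t))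

/-- The periodic heat kernel H_t(x) = Σ_{n ∈ ℤ^d} P_t(x − n). -/
def pHeatK (d : ℕ) (t : ℝ) (x : EuclideanSpace ℝ (Fin d)) : ℝ :=
  ∑' n : ZLat d, heatK d t (x - latVec n)

/-- Partial derivative in the j-th coordinate direction. -/
def pderiv {d : ℕ} (j : Fin d) (f : EuclideanSpace ℝ (Fin d) → ℝ)
    (x : EuclideanSpace ℝ (Fin d)) : ℝ :=
  fderiv ℝ f x (EuclideanSpace.single j 1)

/-- The constant c_d = π^{-d/2} Γ((d+2)/2). -/
def cConst (d : ℕ) : ℝ := π ^ (-(d : ℝ) / 2) * Real.Gamma (((d : ℝ) + 2) / 2)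

/-- The discrete second-order Riesz kernel K_dis^{(jk)}. -/
def discK (d : ℕ) (j k : Fin d) (m : ZLat d) : ℝ :=
  if m = 0 then 0 else cConst d * (m j : ℝ) * (m k : ℝ) / ‖latVec m‖ ^ (d + 2)

/-- The discrete second-order Riesz transform R_dis^{(jk)}. -/
def Rdis (d : ℕ) (j k : Fin d) (f : ZLat d → ℝ) (n : ZLat d) : ℝ :=
  ∑' m : ZLat d, discK d j k m * f (n - m)

/-- The probabilistic kernel 𝒦^{(jk)}(m). -/
def probK (d : ℕ) (j k : Fin d) (m : ZLat d) : ℝ :=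
  -∫ s in Set.Ioi (0 : ℝ), ∫ x : EuclideanSpace ℝ (Fin d),
      pHeatK d s x *
        (pderiv j (fun y => heatK d s y / pHeatK d s y) x *
         pderiv k (fun y => heatK d s (y - latVec m) / pHeatK d s y) x)

/-- The probabilistic discrete second-order Riesz transform 𝓡^{(jk)}. -/
def Rprob (d : ℕ) (j k : Fin d) (f : ZLat d → ℝ) (n : ZLat d) : ℝ :=
  ∑' m : ZLat d, probK d j k (n - m) * f m

/-- The ℓ^p norm of f : ℤ^d → ℝ. -/
def lpN (d : ℕ) (p : ℝ) (f : ZLat d → ℝ) : ℝ := (∑' n : ZLat d, |f n| ^ p) ^ (1 / p)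

/-- Membership in ℓ^p(ℤ^d). -/
def MemLpLat (d : ℕ) (p : ℝ) (f : ZLat d → ℝ) : Prop := Summable fun n : ZLat d => |f n| ^ p

/-- Operator norm of an operator on ℓ^p(ℤ^d): sup of ‖Tf‖ over ‖f‖ = 1. -/
def opN (d : ℕ) (p : ℝ) (T : (ZLat d → ℝ) → (ZLat d → ℝ)) : ℝ :=
  sSup {c : ℝ | ∃ f : ZLat d → ℝ, MemLpLat d p f ∧ lpN d p f = 1 ∧ c = lpN d p (T f)}

/-- p* = max{p, p/(p-1)}. -/
def pstar (p : ℝ) : ℝ := max p (p / (p - 1))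


abbrev EE (d : ℕ) := EuclideanSpace ℝ (Fin d)

/-- rounding to the lattice -/
def rho (d : ℕ) (h : ℝ) (y : EE d) : ZLat d := fun i => round (y i / h)

lemma measurable_rho (d : ℕ) (h : ℝ) : Measurable (rho d h) := by
  refine measurable_pi_lambda _ fun i => ?_
  have : (fun y : EE d => rho d h y i) = fun y => ⌊y i / h + 1/2⌋ := by
    ext y; simp [rho, round_eq]
  rw [this]
  apply Measurable.floor
  have : Measurable (fun y : EE d => y i) := by fun_prop
  fun_prop

lemma latVec_apply {d : ℕ} (m : ZLat d) (i : Fin d) : latVec m i = (m i : ℝ) := rfl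

lemma latVec_sub {d : ℕ} (m n : ZLat d) : latVec (m - n) = latVec m - latVec n := by
  ext i; simp [latVec_apply]

lemma rho_add {d : ℕ} {h : ℝ} (hh : 0 < h) (x : EE d) (n : ZLat d) :
    rho d h (x + h • latVec n) = rho d h x + n := by
  ext i
  have : (x i + h * (n i : ℝ)) / h = x i / h + (n i : ℝ) := by field_simp
  simp [rho, latVec_apply, this]

lemma fiber_meas (d : ℕ) (h : ℝ) (n : ZLat d) : MeasurableSet {y : EE d | rho d h y = n} :=
  measurable_rho d h (measurableSet_singleton n)

lemma iUnion_fiber (d : ℕ) (h : ℝ) : (⋃ n : ZLat d, {y : EE d | rho d h y = n}) = Set.univ := by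
  ext y; simp

lemma disj_fiber (d : ℕ) (h : ℝ) :
    Pairwise (Function.onFun Disjoint fun n : ZLat d => {y : EE d | rho d h y = n}) := by
  intro m n hmn
  rw [Function.onFun, Set.disjoint_left]
  intro y hy hy'
  exact hmn (hy.symm.trans hy')

lemma tiling {d : ℕ} {h : ℝ} (hh : 0 < h) (g : EE d → ENNReal) :
    ∫⁻ x, g x = ∑' n : ZLat d, ∫⁻ x in {y : EE d | rho d h y = 0}, g (x + h • latVec n) := by
  rw [← setLIntegral_univ, ← iUnion_fiber d h,
    lintegral_iUnion (fun n => fiber_meas d h n) (disj_fiber d h)]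
  congr 1; ext n
  have := (measurePreserving_add_right (volume : Measure (EE d)) (h • latVec n)).setLIntegral_comp_preimage_emb
    (measurableEmbedding_addRight _) g {y : EE d | rho d h y = n}
  rw [← this]
  congr 2
  ext y
  simp [rho_add hh]

lemma vol_fiber {d : ℕ} {h : ℝ} (hh : 0 < h) (n : ZLat d) :
    volume {y : EE d | rho d h y = n} = ENNReal.ofReal (h ^ d) := by
  have h1 : {y : EE d | rho d h y = n} = (MeasurableEquiv.toLp 2 (Fin d → ℝ)).symm ⁻¹'
      (Set.univ.pi fun i => Set.Ico (h * (n i - 1/2 : ℝ)) (h * (n i + 1/2 : ℝ))) := by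
    ext y
    simp only [rho, funext_iff, round_eq, Int.floor_eq_iff, Set.mem_ofPred_eq, Set.mem_preimage,
      Set.mem_pi, Set.mem_univ, true_imp_iff, Set.mem_Ico]
    refine forall_congr' fun i => ?_
    change _ ↔ h * (n i - 1/2 : ℝ) ≤ y i ∧ y i < h * (n i + 1/2 : ℝ)
    rw [← sub_le_iff_le_add, le_div_iff₀ hh, ← lt_sub_iff_add_lt, div_lt_iff₀ hh]
    constructor <;> rintro ⟨a, b⟩ <;> constructor <;> linarith
  rw [h1, (EuclideanSpace.volume_preserving_symm_measurableEquiv_toLp (Fin d)).measure_preimage_emb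
    (MeasurableEquiv.measurableEmbedding _), Real.volume_pi_Ico]
  have : ∀ i, h * (n i + 1/2 : ℝ) - h * (n i - 1/2 : ℝ) = h := fun i => by ring
  simp only [this]
  simp [ENNReal.ofReal_pow hh.le]

lemma abs_rho_sub {d : ℕ} {h : ℝ} (hh : 0 < h) (y : EE d) :
    ‖h • latVec (rho d h y) - y‖ ≤ d * h := by
  rw [EuclideanSpace.norm_eq, Real.sqrt_le_left (by positivity)]
  have : ∀ i, ‖(h • latVec (rho d h y) - y) i‖ ^ 2 ≤ h ^ 2 := by
    intro i
    have h1 : (h • latVec (rho d h y) - y) i = - (h * (y i / h - round (y i / h))) := by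
      simp [latVec_apply, rho]; field_simp; ring
    have h2 := abs_sub_round (y i / h)
    rw [h1, norm_neg, Real.norm_eq_abs, abs_mul, abs_of_pos hh, mul_pow]
    have : |y i / h - round (y i / h)| ^ 2 ≤ 1 := by
      apply pow_le_one₀ (abs_nonneg _); linarith
    nlinarith [sq_nonneg h]
  calc _ ≤ ∑ i : Fin d, h ^ 2 := Finset.sum_le_sum fun i _ => this i
    _ = d * h ^ 2 := by simp
    _ ≤ (d * h) ^ 2 := by
      rw [mul_pow]
      gcongr
      rcases Nat.eq_zero_or_pos d with rfl | hd
      · simp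
      · exact_mod_cast Nat.le_self_pow (by norm_num) d

lemma le_norm_rho {d : ℕ} {h : ℝ} (hh : 0 < h) (m : ZLat d) (hm : m ≠ 0) :
    h ≤ ‖h • latVec m‖ := by
  obtain ⟨i, hi⟩ := Function.ne_iff.mp hm
  have h1 : ‖(latVec m) i‖ ≤ ‖latVec m‖ := PiLp.norm_apply_le _ i
  have h2 : (1:ℝ) ≤ ‖(latVec m) i‖ := by
    rw [latVec_apply, Real.norm_eq_abs]
    exact_mod_cast Int.one_le_abs hi
  rw [norm_smul, Real.norm_eq_abs, abs_of_pos hh]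
  nlinarith

lemma norm_le_rho {d : ℕ} {h : ℝ} (hh : 0 < h) (y : EE d) (hy : rho d h y ≠ 0) :
    ‖y‖ ≤ (d + 1) * ‖h • latVec (rho d h y)‖ := by
  have h1 := abs_rho_sub hh y
  have h2 := le_norm_rho hh _ hy
  have h3 : ‖y‖ ≤ ‖h • latVec (rho d h y)‖ + ‖h • latVec (rho d h y) - y‖ := by
    have := norm_sub_norm_le y (h • latVec (rho d h y))
    rw [norm_sub_rev] at this
    linarith
  nlinarith [(Nat.cast_nonneg d : (0:ℝ) ≤ d)]

/-- The dominating function. -/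
def Bd (d : ℕ) (C R : ℝ) (y : EE d) : ℝ := if ‖y‖ ≤ R then C * (‖y‖ ^ (d - 1))⁻¹ else 0

lemma integrable_Bd {d : ℕ} (hd : 2 ≤ d) (C R : ℝ) : Integrable (Bd d C R) := by
  have : Nontrivial (EE d) := by
    have : Nonempty (Fin d) := ⟨⟨0, by omega⟩⟩
    infer_instance
  have := integrable_fun_norm_addHaar (volume : Measure (EE d))
    (f := fun r : ℝ => if r ≤ R then C * (r ^ (d - 1))⁻¹ else 0)
  refine this.2 ?_
  have h2 : IntegrableOn (fun r : ℝ => (Set.Iic R).indicator (fun _ => C) r) (Set.Ioi 0) := by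
    rw [integrableOn_indicator_iff measurableSet_Iic, Set.inter_comm, Set.Ioi_inter_Iic]
    simp
  refine h2.congr_fun ?_ measurableSet_Ioi
  intro r hr
  have hr : 0 < r := hr
  simp only [finrank_euclideanSpace, Fintype.card_fin, smul_eq_mul, Set.indicator, Set.mem_Iic]
  split_ifs
  · field_simp
  · simp

lemma tendsto_rho {d : ℕ} (y : EE d) :
    Tendsto (fun h : ℝ => h • latVec (rho d h y)) (nhdsWithin 0 (Set.Ioi 0)) (nhds y) := by
  rw [tendsto_iff_norm_sub_tendsto_zero]
  have h1 : Tendsto (fun h : ℝ => d * h) (nhdsWithin 0 (Set.Ioi 0)) (nhds 0) := by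
    have : Tendsto (fun h : ℝ => d * h) (nhds 0) (nhds (d * 0)) := by
      apply Continuous.tendsto; fun_prop
    simpa using this.mono_left nhdsWithin_le_nhds
  refine squeeze_zero' (Eventually.of_forall fun h => norm_nonneg _) ?_ h1
  filter_upwards [self_mem_nhdsWithin] with h hh
  exact abs_rho_sub hh y

lemma riemann {d : ℕ} (hd : 2 ≤ d) (g : EE d → ℝ) (C R : ℝ) (hC : 0 ≤ C)
    (hg : ∀ y, |g y| ≤ C * (‖y‖ ^ (d - 1))⁻¹) (hR : ∀ y, R < ‖y‖ → g y = 0)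
    (hc : ∀ y, y ≠ 0 → ContinuousAt g y) :
    Tendsto (fun h : ℝ => ∑' m : ZLat d, h ^ d * g (h • latVec m)) (nhdsWithin 0 (Set.Ioi 0))
      (nhds (∫ y, g y)) := by
  have : Nontrivial (EE d) := by
    have : Nonempty (Fin d) := ⟨⟨0, by omega⟩⟩
    infer_instance
  have hg0 : g 0 = 0 := by
    have := hg 0
    rw [norm_zero, zero_pow (by omega), inv_zero, mul_zero] at this
    exact abs_eq_zero.mp (le_antisymm this (abs_nonneg _))
  have hmeas : ∀ h : ℝ, Measurable fun y => g (h • latVec (rho d h y)) := fun h =>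
    (measurable_of_countable (fun m : ZLat d => g (h • latVec m))).comp (measurable_rho d h)
  have hdom : ∀ h : ℝ, 0 < h → ∀ y, ‖g (h • latVec (rho d h y))‖ ≤
      Bd d (C * (d + 1) ^ (d - 1)) ((d + 1) * R) y := by
    intro h hh y
    have hpos : 0 ≤ Bd d (C * (d + 1) ^ (d - 1)) ((d + 1) * R) y := by
      unfold Bd; split_ifs <;> positivity
    by_cases hy : rho d h y = 0
    · have : h • latVec (rho d h y) = 0 := by
        rw [hy]; ext i; simp [latVec_apply]
      rw [this, hg0]; simpa using hpos
    · have h1 := norm_le_rho hh y hy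
      have h2 := le_norm_rho hh _ hy
      set z := h • latVec (rho d h y)
      by_cases hz : R < ‖z‖
      · rw [hR z hz]; simpa using hpos
      · push Not at hz
        have h3 : ‖y‖ ≤ (d + 1) * R := h1.trans (by gcongr)
        rw [Bd, if_pos h3, Real.norm_eq_abs]
        have hy0 : 0 < ‖y‖ := by
          rw [norm_pos_iff]
          rintro rfl
          apply hy
          ext i; simp [rho]
        have hz0 : 0 < ‖z‖ := by linarith
        refine (hg z).trans ?_
        rw [mul_assoc]
        gcongr
        rw [← div_eq_mul_inv, le_div_iff₀ (by positivity), inv_mul_le_iff₀ (by positivity), mul_comm, ← mul_pow]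
        gcongr
  have hint : ∀ h : ℝ, 0 < h → Integrable fun y => g (h • latVec (rho d h y)) := fun h hh =>
    (integrable_Bd hd _ _).mono' (hmeas h).aestronglyMeasurable
      (Eventually.of_forall (hdom h hh))
  have hsum : ∀ h : ℝ, 0 < h → ∑' m : ZLat d, h ^ d * g (h • latVec m) =
      ∫ y, g (h • latVec (rho d h y)) := by
    intro h hh
    rw [← setIntegral_univ, ← iUnion_fiber d h, integral_iUnion (fun n => fiber_meas d h n)
      (disj_fiber d h) (hint h hh).integrableOn]
    congr 1; ext n
    have : ∫ y in {y : EE d | rho d h y = n}, g (h • latVec (rho d h y)) =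
        ∫ y in {y : EE d | rho d h y = n}, g (h • latVec n) := by
      apply setIntegral_congr_fun (fiber_meas d h n)
      intro y hy
      have hy : rho d h y = n := hy
      simp only [hy]
    rw [this, setIntegral_const, measureReal_def, vol_fiber hh, ENNReal.toReal_ofReal (by positivity), smul_eq_mul]
  have main : Tendsto (fun h : ℝ => ∫ y, g (h • latVec (rho d h y))) (nhdsWithin 0 (Set.Ioi 0))
      (nhds (∫ y, g y)) := by
    refine tendsto_integral_filter_of_dominated_convergence
      (Bd d (C * (d + 1) ^ (d - 1)) ((d + 1) * R)) ?_ ?_ (integrable_Bd hd _ _) ?_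
    · exact Eventually.of_forall fun h => (hmeas h).aestronglyMeasurable
    · filter_upwards [self_mem_nhdsWithin] with h hh
      exact Eventually.of_forall (hdom h hh)
    · have : ∀ᵐ y : EE d, y ≠ 0 := by
        simp [ae_iff]
      filter_upwards [this] with y hy
      exact (hc y hy).tendsto.comp (tendsto_rho y)
  refine main.congr' ?_
  filter_upwards [self_mem_nhdsWithin] with h hh
  exact (hsum h hh).symm

lemma latVec_injective {d : ℕ} : Function.Injective (latVec (d := d)) := by
  intro m n h
  ext i
  have := congrArg (fun v : EE d => v i) h
  simpa [latVec_apply] using this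

lemma summable_latVec {d : ℕ} (r : ℝ) (hr : r < -d) :
    Summable fun m : ZLat d => ‖latVec m‖ ^ r := by
  let b := (EuclideanSpace.basisFun (Fin d) ℝ).toBasis
  let L := Submodule.span ℤ (Set.range b)
  have hL : Module.finrank ℤ L = d := by
    rw [ZLattice.rank ℝ L]; simp
  have hs := ZLattice.summable_norm_rpow L r (by rw [hL]; exact hr)
  have hmem : ∀ m : ZLat d, latVec m ∈ L := by
    intro m
    have : latVec m = ∑ i, m i • b i := by
      ext i
      simp [b, latVec_apply, Finset.sum_apply, Pi.single_apply]
    rw [this]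
    exact Submodule.sum_mem _ fun i _ => Submodule.smul_mem _ _ (Submodule.subset_span ⟨i, rfl⟩)
  have hi : Function.Injective (fun m : ZLat d => (⟨latVec m, hmem m⟩ : L)) := by
    intro m n h
    exact latVec_injective (congrArg Subtype.val h)
  have h5 := hs.comp_injective hi
  refine h5.congr fun m => ?_
  simp only [Function.comp, Submodule.coe_norm]

lemma summable_K {d : ℕ} (hd : 2 ≤ d) {p : ℝ} (hp : 1 < p) (K : EE d → ℝ) (A : ℝ) (hA : 0 ≤ A)
    (hK : ∀ y, |K y| ≤ A * (‖y‖ ^ d)⁻¹) : Summable fun m : ZLat d => |K (latVec m)| ^ p := by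
  have hd' : (2:ℝ) ≤ d := by exact_mod_cast hd
  have := (summable_latVec (d := d) (-(d * p)) (by nlinarith)).mul_left (A ^ p)
  refine Summable.of_nonneg_of_le (fun m => by positivity) (fun m => ?_) this
  calc |K (latVec m)| ^ p ≤ (A * (‖latVec m‖ ^ d)⁻¹) ^ p := by
        gcongr; exact hK _
    _ = _ := by
        rw [Real.mul_rpow hA (by positivity), ← Real.rpow_natCast, ← Real.rpow_neg (norm_nonneg _),
          ← Real.rpow_mul (norm_nonneg _), neg_mul]

lemma conv_eq {d : ℕ} (k f : ZLat d → ℝ) (hf : (Function.support f).Finite) (n : ZLat d) :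
    ∑' m, k m * f (n - m) = ∑ l ∈ hf.toFinset, f l * k (n - l) := by
  rw [← (Equiv.subLeft n).tsum_eq]
  simp only [Equiv.subLeft_apply, sub_sub_cancel]
  rw [tsum_eq_sum (s := hf.toFinset)]
  · exact Finset.sum_congr rfl fun l _ => mul_comm _ _
  · intro l hl
    have : f l = 0 := by simpa using hl
    rw [this, mul_zero]

lemma summable_conv {d : ℕ} {p : ℝ} (hp : 1 < p) (k f : ZLat d → ℝ)
    (hf : (Function.support f).Finite) (hk : Summable fun m => |k m| ^ p) :
    Summable fun n => |∑' m, k m * f (n - m)| ^ p := by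
  have hp0 : 0 < p := by linarith
  have hpr : (ENNReal.ofReal p).toReal = p := ENNReal.toReal_ofReal hp0.le
  have hp' : 0 < (ENNReal.ofReal p).toReal := by rw [hpr]; exact hp0
  have key : ∀ g : ZLat d → ℝ, Memℓp g (ENNReal.ofReal p) ↔ Summable fun m => |g m| ^ p := by
    intro g
    rw [memℓp_gen_iff hp', hpr]; rfl
  rw [← key]
  have : (fun n => ∑' m, k m * f (n - m)) = fun n => ∑ l ∈ hf.toFinset, (f l • fun n => k (n - l)) n := by
    ext n; rw [conv_eq k f hf n]; rfl
  rw [this]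
  apply Memℓp.finsetSum
  intro l _
  apply Memℓp.const_smul
  rw [key]
  exact (Equiv.subRight l).summable_iff.mpr hk

lemma shift_ineq {d : ℕ} {p : ℝ} (hp : 1 < p) (k f : ZLat d → ℝ) {M : ℝ} (hM : 0 ≤ M)
    (hf : (Function.support f).Finite) (hk : Summable fun m => |k m| ^ p)
    (hb : lpN d p (fun n => ∑' m, k m * f (n - m)) ≤ M * lpN d p f) :
    ∑' n, ENNReal.ofReal (|∑' m, k m * f (n - m)| ^ p) ≤
      ENNReal.ofReal (M ^ p) * ∑' n, ENNReal.ofReal (|f n| ^ p) := by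
  have hp0 : 0 < p := by linarith
  have h1 := summable_conv hp k f hf hk
  have h2 : Summable fun n => |f n| ^ p := by
    apply summable_of_hasFiniteSupport
    refine hf.subset fun n hn => ?_
    intro h0
    apply hn
    simp [h0, Real.zero_rpow hp0.ne']
  rw [← ENNReal.ofReal_tsum_of_nonneg (fun n => by positivity) h1,
    ← ENNReal.ofReal_tsum_of_nonneg (fun n => by positivity) h2,
    ← ENNReal.ofReal_mul (by positivity)]
  apply ENNReal.ofReal_le_ofReal
  unfold lpN at hb
  have hs1 : 0 ≤ ∑' n, |∑' m, k m * f (n - m)| ^ p := tsum_nonneg fun n => by positivity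
  have hs2 : 0 ≤ ∑' n, |f n| ^ p := tsum_nonneg fun n => by positivity
  have h3 := Real.rpow_le_rpow (by positivity) hb hp0.le
  rwa [Real.mul_rpow hM (by positivity), ← Real.rpow_mul hs1, ← Real.rpow_mul hs2,
    one_div_mul_cancel hp0.ne', Real.rpow_one, Real.rpow_one] at h3

lemma finite_lat {d : ℕ} {h : ℝ} (hh : 0 < h) (x : EE d) (R : ℝ) :
    {n : ZLat d | ‖x + h • latVec n‖ ≤ R}.Finite := by
  obtain ⟨N, hN⟩ := exists_nat_ge ((R + ‖x‖) / h)
  refine (Set.finite_Icc (fun _ : Fin d => -(N:ℤ)) (fun _ => (N:ℤ))).subset ?_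
  intro n hn
  have hn : ‖x + h • latVec n‖ ≤ R := hn
  have h1 : ‖h • latVec n‖ ≤ R + ‖x‖ := by
    have := norm_sub_le (x + h • latVec n) x
    rw [add_sub_cancel_left] at this
    linarith
  rw [norm_smul, Real.norm_eq_abs, abs_of_pos hh, ← le_div_iff₀' hh] at h1
  have h2 : ∀ i, |n i| ≤ (N:ℤ) := by
    intro i
    have h3 : ‖(latVec n) i‖ ≤ ‖latVec n‖ := PiLp.norm_apply_le _ i
    rw [latVec_apply, Real.norm_eq_abs] at h3
    exact_mod_cast h3.trans (h1.trans hN)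
  exact ⟨fun i => (abs_le.mp (h2 i)).1, fun i => (abs_le.mp (h2 i)).2⟩

/-- The rescaled discrete operator acting on functions on `ℝ^d`. -/
def Th {d : ℕ} (K F : EE d → ℝ) (h : ℝ) (x : EE d) : ℝ :=
  ∑' m : ZLat d, K (latVec m) * F (x - h • latVec m)

lemma finite_supp_sub {d : ℕ} {h : ℝ} (hh : 0 < h) (F : EE d → ℝ) (R : ℝ)
    (hR : ∀ y, R < ‖y‖ → F y = 0) (x : EE d) :
    (Function.support fun m : ZLat d => F (x - h • latVec m)).Finite := by
  refine (finite_lat hh (-x) R).subset fun n hn => ?_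
  by_contra h0
  apply hn
  apply hR
  have h0 : ¬ (‖-x + h • latVec n‖ ≤ R) := h0
  have h1 : ‖x - h • latVec n‖ = ‖-x + h • latVec n‖ := by
    rw [← norm_neg]; congr 1; abel
  rw [h1]; exact not_le.mp h0

lemma finite_supp_add {d : ℕ} {h : ℝ} (hh : 0 < h) (F : EE d → ℝ) (R : ℝ)
    (hR : ∀ y, R < ‖y‖ → F y = 0) (x : EE d) :
    (Function.support fun m : ZLat d => F (x + h • latVec m)).Finite := by
  refine (finite_lat hh x R).subset fun n hn => ?_
  by_contra h0
  apply hn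
  apply hR
  have h0 : ¬ (‖x + h • latVec n‖ ≤ R) := h0
  exact not_le.mp h0

lemma Th_meas {d : ℕ} {h : ℝ} (hh : 0 < h) (K F : EE d → ℝ) (hF : Continuous F) (R : ℝ)
    (hR : ∀ y, R < ‖y‖ → F y = 0) : Measurable (Th K F h) := by
  have hs : ∀ x, Summable fun m : ZLat d => K (latVec m) * F (x - h • latVec m) := by
    intro x
    apply summable_of_hasFiniteSupport
    refine (finite_supp_sub hh F R hR x).subset fun m hm h0 => hm ?_
    have h0 : F (x - h • latVec m) = 0 := h0
    simp [h0]
  refine measurable_of_tendsto_metrizable' (atTop : Filter (Finset (ZLat d)))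
    (f := fun s x => ∑ m ∈ s, K (latVec m) * F (x - h • latVec m)) ?_ ?_
  · intro s
    apply Continuous.measurable
    fun_prop
  · rw [tendsto_pi_nhds]
    intro x
    exact (hs x).hasSum

lemma Th_bound {d : ℕ} {p : ℝ} (hp : 1 < p) {h : ℝ} (hh : 0 < h) (K F : EE d → ℝ)
    (hF : Continuous F) (R : ℝ) (hR : ∀ y, R < ‖y‖ → F y = 0) {M : ℝ} (hM : 0 ≤ M)
    (hk : Summable fun m : ZLat d => |K (latVec m)| ^ p)
    (hb : ∀ f : ZLat d → ℝ, (Function.support f).Finite →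
      lpN d p (fun n => ∑' m, K (latVec m) * f (n - m)) ≤ M * lpN d p f) :
    ∫⁻ x, ENNReal.ofReal (|Th K F h x| ^ p) ≤
      ENNReal.ofReal (M ^ p) * ∫⁻ x, ENNReal.ofReal (|F x| ^ p) := by
  have hTm := Th_meas hh K F hF R hR
  have hFm := hF.measurable
  rw [tiling hh, tiling hh (fun x => ENNReal.ofReal (|F x| ^ p)),
    ← lintegral_tsum, ← lintegral_tsum, ← lintegral_const_mul]
  · apply lintegral_mono
    intro x
    have hs := finite_supp_add hh F R hR x
    have h7 := shift_ineq hp (fun m => K (latVec m)) (fun m : ZLat d => F (x + h • latVec m))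
      hM hs hk (hb _ hs)
    have h8 : ∀ n : ZLat d, Th K F h (x + h • latVec n) =
        ∑' m : ZLat d, K (latVec m) * F (x + h • latVec (n - m)) := by
      intro n
      unfold Th
      simp only [latVec_sub, smul_sub, add_sub_assoc]
    simp only [← h8] at h7
    exact h7
  · apply Measurable.ennreal_tsum; intro n; fun_prop
  · intro n; apply Measurable.aemeasurable; fun_prop
  · intro n; apply Measurable.aemeasurable
    have : Measurable fun x => Th K F h (x + h • latVec n) := hTm.comp (measurable_add_const _)
    fun_prop

/-- Cutoff. -/
def phi {d : ℕ} (y : EE d) : ℝ := max 0 (1 - ‖y‖)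

/-- Regularised difference. -/
def Gx {d : ℕ} (F : EE d → ℝ) (x y : EE d) : ℝ := F (x - y) - F x * phi y

lemma phi_cont {d : ℕ} : Continuous (phi (d := d)) := by unfold phi; fun_prop

lemma phi_zero {d : ℕ} (y : EE d) (hy : 1 < ‖y‖) : phi y = 0 := by
  unfold phi; rw [max_eq_left]; linarith

lemma phi_sub {d : ℕ} (y : EE d) : |1 - phi y| ≤ ‖y‖ := by
  unfold phi
  have := norm_nonneg y
  rw [abs_le]
  rcases max_cases 0 (1 - ‖y‖) with ⟨h1, h2⟩ | ⟨h1, h2⟩ <;> rw [h1] <;> constructor <;> linarith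

lemma phi_abs {d : ℕ} (y : EE d) : |phi y| ≤ 1 := by
  unfold phi
  have := norm_nonneg y
  rw [abs_le]
  rcases max_cases 0 (1 - ‖y‖) with ⟨h1, h2⟩ | ⟨h1, h2⟩ <;> rw [h1] <;> constructor <;> linarith

lemma Gx_bound {d : ℕ} (F : EE d → ℝ) {L : NNReal} (hL : LipschitzWith L F) (x y : EE d) :
    |Gx F x y| ≤ (L + |F x|) * ‖y‖ := by
  have h1 : |F (x - y) - F x| ≤ L * ‖y‖ := by
    have := hL.dist_le_mul (x - y) x
    rw [Real.dist_eq, dist_eq_norm] at this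
    simpa using this
  have h2 : Gx F x y = (F (x - y) - F x) + F x * (1 - phi y) := by unfold Gx; ring
  rw [h2]
  refine (abs_add_le _ _).trans ?_
  rw [abs_mul, add_mul]
  have := phi_sub y
  gcongr

lemma Gx_zero {d : ℕ} (F : EE d → ℝ) (R : ℝ) (hR : ∀ y, R < ‖y‖ → F y = 0) (x y : EE d)
    (hy : max 1 (R + ‖x‖) < ‖y‖) : Gx F x y = 0 := by
  have h1 := lt_of_le_of_lt (le_max_left _ _) hy
  have h2 := lt_of_le_of_lt (le_max_right _ _) hy
  rw [Gx, phi_zero y h1, hR]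
  · ring
  · have := norm_sub_norm_le y x
    rw [norm_sub_rev] at this
    linarith

section key
variable {d : ℕ} (hd : 2 ≤ d) (K F : EE d → ℝ) (A : ℝ) (hA : 0 ≤ A)
    (hKb : ∀ y, |K y| ≤ A * (‖y‖ ^ d)⁻¹)
    (hKc : ∀ y, y ≠ 0 → ContinuousAt K y) (hKm : Measurable K)
    (hKh : ∀ h : ℝ, 0 < h → ∀ y, h ^ d * K (h • y) = K y)
    (σ : EE d ≃ₗᵢ[ℝ] EE d) (τ : ZLat d ≃ ZLat d) (hστ : ∀ m, latVec (τ m) = σ (latVec m))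
    (hKσ : ∀ y, K (σ y) = - K y)
    (L : NNReal) (hL : LipschitzWith L F) (R : ℝ) (hR : ∀ y, R < ‖y‖ → F y = 0)

include hd hA hKb hL in
lemma KG_bound (x y : EE d) : |K y * Gx F x y| ≤ A * (L + |F x|) * (‖y‖ ^ (d - 1))⁻¹ := by
  have h1 := hKb y
  have h2 := Gx_bound F hL x y
  rw [abs_mul]
  have h3 : (‖y‖ ^ d)⁻¹ * ‖y‖ ≤ (‖y‖ ^ (d - 1))⁻¹ := by
    obtain ⟨e, rfl⟩ : ∃ e, d = e + 1 := ⟨d - 1, by omega⟩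
    rcases (norm_nonneg y).eq_or_lt with h | h
    · rw [← h]; simp
    · rw [Nat.add_sub_cancel, pow_succ]; apply le_of_eq; field_simp
  calc |K y| * |Gx F x y| ≤ (A * (‖y‖ ^ d)⁻¹) * ((L + |F x|) * ‖y‖) := by gcongr
    _ = A * (L + |F x|) * ((‖y‖ ^ d)⁻¹ * ‖y‖) := by ring
    _ ≤ _ := by gcongr

include hd hA hKb hL hR hKm in
lemma KG_int (x : EE d) : Integrable fun y => K y * Gx F x y := by
  refine (integrable_Bd hd (A * (L + |F x|)) (max 1 (R + ‖x‖))).mono' ?_ ?_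
  · have := hL.continuous.measurable
    have := (phi_cont (d := d)).measurable
    apply Measurable.aestronglyMeasurable
    unfold Gx
    fun_prop
  · refine Eventually.of_forall fun y => ?_
    unfold Bd
    split_ifs with h
    · exact KG_bound hd K F A hA hKb L hL x y
    · rw [Gx_zero F R hR x y (not_le.mp h)]; simp

include hd hA hKb hL hR hKc hKh hστ hKσ in
lemma Th_tendsto (x : EE d) : Tendsto (fun h => Th K F h x) (nhdsWithin 0 (Set.Ioi 0))
    (nhds (∫ y, K y * Gx F x y)) := by
  have hFc := hL.continuous
  have := riemann hd (fun y => K y * Gx F x y) (A * (L + |F x|)) (max 1 (R + ‖x‖)) (by positivity)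
    (KG_bound hd K F A hA hKb L hL x) (fun y hy => by rw [Gx_zero F R hR x y hy, mul_zero])
    (fun y hy => (hKc y hy).mul (by
      apply Continuous.continuousAt
      have := phi_cont (d := d)
      unfold Gx; fun_prop))
  refine this.congr' ?_
  filter_upwards [self_mem_nhdsWithin] with h hh
  have hh : 0 < h := hh
  have e1 : ∀ m : ZLat d, h ^ d * (K (h • latVec m) * Gx F x (h • latVec m)) =
      K (latVec m) * F (x - h • latVec m) - F x * (K (latVec m) * phi (h • latVec m)) := by
    intro m
    rw [← mul_assoc, hKh h hh, Gx]; ring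
  have s1 : Summable fun m : ZLat d => K (latVec m) * F (x - h • latVec m) := by
    apply summable_of_hasFiniteSupport
    refine (finite_supp_sub hh F R hR x).subset fun m hm h0 => hm ?_
    have h0 : F (x - h • latVec m) = 0 := h0
    simp [h0]
  have s2 : Summable fun m : ZLat d => K (latVec m) * phi (h • latVec m) := by
    apply summable_of_hasFiniteSupport
    refine (finite_supp_add hh phi 1 phi_zero 0).subset fun m hm h0 => hm ?_
    have h0 : phi (0 + h • latVec m) = 0 := h0
    rw [zero_add] at h0
    simp [h0]
  have z2 : ∑' m : ZLat d, K (latVec m) * phi (h • latVec m) = 0 := by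
    have e := τ.tsum_eq (fun m : ZLat d => K (latVec m) * phi (h • latVec m))
    have e' : ∀ m, K (latVec (τ m)) * phi (h • latVec (τ m)) =
        -(K (latVec m) * phi (h • latVec m)) := by
      intro m
      have : phi (h • σ (latVec m)) = phi (h • latVec m) := by
        unfold phi; rw [norm_smul, norm_smul, σ.norm_map]
      rw [hστ, hKσ, this]; ring
    simp only [e', tsum_neg] at e
    linarith
  simp only [e1]
  rw [s1.tsum_sub (s2.mul_left _), tsum_mul_left, z2, mul_zero, sub_zero]
  rfl

include hd hA hKb hL hR hKm hKσ in
lemma pv_tendsto (x : EE d) : Tendsto (fun r : ℝ => ∫ y in {y : EE d | r < ‖y‖}, K y * F (x - y))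
    (nhdsWithin 0 (Set.Ioi 0)) (nhds (∫ y, K y * Gx F x y)) := by
  have : Nontrivial (EE d) := by
    have : Nonempty (Fin d) := ⟨⟨0, by omega⟩⟩
    infer_instance
  have hint := KG_int hd K F A hA hKb hKm L hL R hR x
  have hms : ∀ r : ℝ, MeasurableSet {y : EE d | r < ‖y‖} := fun r =>
    measurableSet_lt measurable_const measurable_norm
  have h1 : Tendsto (fun r : ℝ => ∫ y in {y : EE d | r < ‖y‖}, K y * Gx F x y)
      (nhdsWithin 0 (Set.Ioi 0)) (nhds (∫ y, K y * Gx F x y)) := by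
    simp only [← integral_indicator (hms _)]
    refine tendsto_integral_filter_of_dominated_convergence (fun y => ‖K y * Gx F x y‖) ?_ ?_
      hint.norm ?_
    · exact Eventually.of_forall fun r => hint.aestronglyMeasurable.indicator (hms r)
    · exact Eventually.of_forall fun r => Eventually.of_forall fun y => norm_indicator_le_norm_self _ _
    · have : ∀ᵐ y : EE d, y ≠ 0 := by simp [ae_iff]
      filter_upwards [this] with y hy
      refine tendsto_const_nhds.congr' ?_
      have : Set.Iio ‖y‖ ∈ nhdsWithin (0:ℝ) (Set.Ioi 0) :=
        mem_nhdsWithin_of_mem_nhds (Iio_mem_nhds (norm_pos_iff.mpr hy))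
      filter_upwards [this] with r hr
      have hr : y ∈ {y : EE d | r < ‖y‖} := hr
      rw [Set.indicator_of_mem hr]
  refine h1.congr' ?_
  filter_upwards [self_mem_nhdsWithin] with r hr
  have hr : 0 < r := hr
  have hi : IntegrableOn (fun y => K y * phi y) {y : EE d | r < ‖y‖} := by
    refine Integrable.mono' ((integrable_Bd hd (A / r) 1).integrableOn) ?_ ?_
    · have := (phi_cont (d := d)).measurable
      apply Measurable.aestronglyMeasurable
      fun_prop
    · refine (ae_restrict_iff' (hms r)).mpr (Eventually.of_forall fun y hy => ?_)
      have hy : r < ‖y‖ := hy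
      unfold Bd
      split_ifs with h
      · rw [norm_mul, Real.norm_eq_abs, Real.norm_eq_abs]
        have hy0 : 0 < ‖y‖ := hr.trans hy
        calc |K y| * |phi y| ≤ (A * (‖y‖ ^ d)⁻¹) * 1 := by
              gcongr
              · exact hKb y
              · exact phi_abs y
          _ ≤ _ := by
              obtain ⟨e, rfl⟩ : ∃ e, d = e + 1 := ⟨d - 1, by omega⟩
              rw [Nat.add_sub_cancel, pow_succ, mul_inv, mul_one, div_eq_mul_inv, mul_assoc,
                mul_comm (r⁻¹)]
              gcongr
      · rw [phi_zero y (not_le.mp h)]; simp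
  have hz : ∫ y in {y : EE d | r < ‖y‖}, K y * phi y = 0 := by
    have e := σ.measurePreserving.setIntegral_preimage_emb σ.toMeasurableEquiv.measurableEmbedding
      (fun y => K y * phi y) {y : EE d | r < ‖y‖}
    have e2 : σ ⁻¹' {y : EE d | r < ‖y‖} = {y : EE d | r < ‖y‖} := by
      ext y; simp
    have e' : ∀ y, K (σ y) * phi (σ y) = -(K y * phi y) := by
      intro y
      have : phi (σ y) = phi y := by unfold phi; rw [σ.norm_map]
      rw [hKσ, this]; ring
    rw [e2] at e
    simp only [e', integral_neg] at e
    linarith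
  have : ∀ y, K y * F (x - y) = K y * Gx F x y + F x * (K y * phi y) := by
    intro y; unfold Gx; ring
  simp only [this]
  rw [integral_add hint.integrableOn (hi.const_mul _), integral_const_mul, hz, mul_zero, add_zero]

include hd hA hKb hL hR hKm hKc hKh hστ hKσ in
lemma key {p : ℝ} (hp : 1 < p) {M : ℝ} (hM : 0 ≤ M)
    (hb : ∀ f : ZLat d → ℝ, (Function.support f).Finite →
      lpN d p (fun n => ∑' m, K (latVec m) * f (n - m)) ≤ M * lpN d p f) :
    ∃ RF : EE d → ℝ,
      (∀ x, Tendsto (fun r : ℝ => ∫ y in {y : EE d | r < ‖y‖}, K y * F (x - y))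
        (nhdsWithin 0 (Set.Ioi 0)) (nhds (RF x))) ∧
      (∫ x, |RF x| ^ p) ^ (1 / p) ≤ M * (∫ x, |F x| ^ p) ^ (1 / p) := by
  have hp0 : 0 < p := by linarith
  refine ⟨fun x => ∫ y, K y * Gx F x y,
    pv_tendsto hd K F A hA hKb hKm σ hKσ L hL R hR, ?_⟩
  have hT := Th_tendsto hd K F A hA hKb hKc hKh σ τ hστ hKσ L hL R hR
  set RF : EE d → ℝ := fun x => ∫ y, K y * Gx F x y with hRF
  have hk := summable_K hd hp K A hA hKb
  have hFc := hL.continuous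
  let u : ℕ → ℝ := fun n => 1 / ((n:ℝ) + 1)
  have hu0 : ∀ n, 0 < u n := fun n => by positivity
  have hu : Tendsto u atTop (nhdsWithin 0 (Set.Ioi 0)) :=
    tendsto_nhdsWithin_iff.mpr ⟨tendsto_one_div_add_atTop_nhds_zero_nat,
      Eventually.of_forall fun n => hu0 n⟩
  have hTu : ∀ x, Tendsto (fun n => Th K F (u n) x) atTop (nhds (RF x)) := fun x =>
    (hT x).comp hu
  have hTm : ∀ n, Measurable (Th K F (u n)) := fun n => Th_meas (hu0 n) K F hFc R hR
  have hRm : Measurable RF := measurable_of_tendsto_metrizable hTm (tendsto_pi_nhds.mpr hTu)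
  have hlin : ∫⁻ x, ENNReal.ofReal (|RF x| ^ p) ≤
      ENNReal.ofReal (M ^ p) * ∫⁻ x, ENNReal.ofReal (|F x| ^ p) := by
    have hlim : ∀ x, liminf (fun n => ENNReal.ofReal (|Th K F (u n) x| ^ p)) atTop =
        ENNReal.ofReal (|RF x| ^ p) := by
      intro x
      apply Tendsto.liminf_eq
      exact ENNReal.tendsto_ofReal (((hTu x).abs).rpow_const (Or.inr hp0.le))
    simp only [← hlim]
    refine (lintegral_liminf_le fun n => ?_).trans ?_
    · have := hTm n
      fun_prop
    · refine liminf_le_of_le (by isBoundedDefault) fun b hb' => ?_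
      obtain ⟨n, hn⟩ := hb'.exists
      exact hn.trans (Th_bound hp (hu0 n) K F hFc R hR hM hk hb)
  have hFi : Integrable fun x => |F x| ^ p := by
    apply Continuous.integrable_of_hasCompactSupport
    · exact hFc.abs.rpow_const fun _ => Or.inr hp0.le
    · apply HasCompactSupport.of_support_subset_isCompact (isCompact_closedBall (0 : EE d) R)
      intro y hy
      rw [mem_closedBall_zero_iff]
      by_contra h
      exact hy (by simp [hR y (not_le.mp h), Real.zero_rpow hp0.ne'])
  have hint : ∫ x, |RF x| ^ p ≤ M ^ p * ∫ x, |F x| ^ p := by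
    rw [integral_eq_lintegral_of_nonneg_ae (Eventually.of_forall fun x => by positivity)
      (by apply Measurable.aestronglyMeasurable; fun_prop)]
    apply ENNReal.toReal_le_of_le_ofReal
    · have : 0 ≤ ∫ x, |F x| ^ p := integral_nonneg fun x => by positivity
      positivity
    · rw [ENNReal.ofReal_mul (by positivity),
        ofReal_integral_eq_lintegral_ofReal hFi (Eventually.of_forall fun x => by positivity)]
      exact hlin
  have n1 : 0 ≤ ∫ x, |RF x| ^ p := integral_nonneg fun x => by positivity
  have n2 : 0 ≤ ∫ x, |F x| ^ p := integral_nonneg fun x => by positivity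
  calc (∫ x, |RF x| ^ p) ^ (1 / p) ≤ (M ^ p * ∫ x, |F x| ^ p) ^ (1 / p) := by gcongr
    _ = _ := by
      rw [Real.mul_rpow (by positivity) n2, ← Real.rpow_mul hM, mul_one_div_cancel hp0.ne',
        Real.rpow_one]
end key

lemma key2 {d : ℕ} (hd : 2 ≤ d) {p : ℝ} (hp : 1 < p) (F : EE d → ℝ)
    (hF : ContDiff ℝ (⊤ : ℕ∞) F) (hFc : HasCompactSupport F) (c : ℝ) (q : EE d → ℝ)
    (hqc : Continuous q) (hqb : ∀ y, |q y| ≤ 2 * ‖y‖ ^ 2)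
    (hqh : ∀ (h : ℝ) y, q (h • y) = h ^ 2 * q y)
    (σ : EE d ≃ₗᵢ[ℝ] EE d) (τ : ZLat d ≃ ZLat d) (hστ : ∀ m, latVec (τ m) = σ (latVec m))
    (hqσ : ∀ y, q (σ y) = - q y) {M : ℝ} (hM : 0 ≤ M)
    (hb : ∀ f : ZLat d → ℝ, (Function.support f).Finite →
      lpN d p (fun n => ∑' m, (c * (q (latVec m) / ‖latVec m‖ ^ (d + 2))) * f (n - m))
        ≤ M * lpN d p f) :
    ∃ RF : EE d → ℝ,
      (∀ x, Tendsto (fun r : ℝ => c * ∫ y in {y : EE d | r < ‖y‖}, q y / ‖y‖ ^ (d + 2) * F (x - y))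
        (nhdsWithin 0 (Set.Ioi 0)) (nhds (RF x))) ∧
      (∫ x, |RF x| ^ p) ^ (1 / p) ≤ M * (∫ x, |F x| ^ p) ^ (1 / p) := by
  obtain ⟨L, hL⟩ := ContDiff.lipschitzWith_of_hasCompactSupport hFc hF (by simp)
  obtain ⟨R, hR⟩ := hFc.isCompact.isBounded.exists_norm_le
  have hR' : ∀ y, R < ‖y‖ → F y = 0 := by
    intro y hy
    by_contra h
    exact absurd (hR y (subset_tsupport F h)) (not_le.mpr hy)
  have := key hd (fun y => c * (q y / ‖y‖ ^ (d + 2))) F (|c| * 2) (by positivity) ?_ ?_ ?_ ?_ σ τ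
    hστ ?_ L hL R hR' hp hM hb
  · simpa only [mul_assoc, integral_const_mul] using this
  · intro y
    rw [abs_mul, mul_assoc]
    gcongr
    rw [abs_div, abs_of_nonneg (by positivity : 0 ≤ ‖y‖ ^ (d + 2))]
    rcases (norm_nonneg y).eq_or_lt with h | h
    · rw [← h]; simp
    · rw [div_le_iff₀ (by positivity)]
      refine (hqb y).trans (le_of_eq ?_)
      rw [pow_add]; field_simp
  · intro y hy
    have : ‖y‖ ^ (d + 2) ≠ 0 := pow_ne_zero _ (norm_ne_zero_iff.mpr hy)
    fun_prop (disch := assumption)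
  · have := hqc.measurable
    fun_prop
  · intro h hh y
    simp only [hqh, norm_smul, Real.norm_eq_abs, abs_of_pos hh, mul_pow]
    rcases (norm_nonneg y).eq_or_lt with h' | h'
    · rw [← h']; simp
    · rw [pow_add h]; field_simp
  · intro y
    simp only [hqσ, σ.norm_map]; ring

lemma abs_coord {d : ℕ} (y : EE d) (i : Fin d) : |y i| ≤ ‖y‖ := PiLp.norm_apply_le y i

lemma discK_eq {d : ℕ} (j k : Fin d) (m : ZLat d) :
    discK d j k m = cConst d * (latVec m j * latVec m k / ‖latVec m‖ ^ (d + 2)) := by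
  unfold discK
  split_ifs with h
  · subst h; simp [latVec_apply]
  · simp only [latVec_apply]; ring

lemma memLat_of_finite {d : ℕ} {p : ℝ} (hp : 1 < p) (f : ZLat d → ℝ)
    (hf : (Function.support f).Finite) : MemLpLat d p f := by
  apply summable_of_hasFiniteSupport
  refine hf.subset fun n hn h0 => hn ?_
  have h0 : f n = 0 := h0
  simp [h0, Real.zero_rpow (by linarith : p ≠ 0)]

lemma summable_fin {d : ℕ} (k f : ZLat d → ℝ) (hf : (Function.support f).Finite) (n : ZLat d) :
    Summable fun m => k m * f (n - m) := by
  apply summable_of_hasFiniteSupport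
  refine (hf.preimage ((Equiv.subLeft n).injective.injOn)).subset fun m hm h0 => hm ?_
  have h0 : f (n - m) = 0 := h0
  simp [h0]

theorem stmt14 (d : ℕ) (hd : 2 ≤ d) (p : ℝ) (hp : 1 < p) (j k : Fin d) (hjk : j ≠ k)
    (F : EuclideanSpace ℝ (Fin d) → ℝ) (hF : ContDiff ℝ (⊤ : ℕ∞) F) (hFc : HasCompactSupport F) :
    (∀ M : ℝ, 0 ≤ M →
      (∀ f : ZLat d → ℝ, MemLpLat d p f → lpN d p (Rdis d j k f) ≤ M * lpN d p f) →
      ∃ RF : EuclideanSpace ℝ (Fin d) → ℝ,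
        (∀ x : EuclideanSpace ℝ (Fin d),
          Filter.Tendsto (fun r : ℝ =>
              cConst d * ∫ y in {y : EuclideanSpace ℝ (Fin d) | r < ‖y‖},
                y j * y k / ‖y‖ ^ (d + 2) * F (x - y))
            (nhdsWithin 0 (Set.Ioi 0)) (nhds (RF x))) ∧
        (∫ x : EuclideanSpace ℝ (Fin d), |RF x| ^ p) ^ (1 / p) ≤
          M * (∫ x : EuclideanSpace ℝ (Fin d), |F x| ^ p) ^ (1 / p)) ∧
    (∀ M' : ℝ, 0 ≤ M' →
      (∀ f : ZLat d → ℝ, MemLpLat d p f →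
        lpN d p (fun n => Rdis d j j f n - Rdis d k k f n) ≤ M' * lpN d p f) →
      ∃ G : EuclideanSpace ℝ (Fin d) → ℝ,
        (∀ x : EuclideanSpace ℝ (Fin d),
          Filter.Tendsto (fun r : ℝ =>
              cConst d * ∫ y in {y : EuclideanSpace ℝ (Fin d) | r < ‖y‖},
                (y j ^ 2 - y k ^ 2) / ‖y‖ ^ (d + 2) * F (x - y))
            (nhdsWithin 0 (Set.Ioi 0)) (nhds (G x))) ∧
        (∫ x : EuclideanSpace ℝ (Fin d), |G x| ^ p) ^ (1 / p) ≤
          M' * (∫ x : EuclideanSpace ℝ (Fin d), |F x| ^ p) ^ (1 / p)) := by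
  constructor
  · intro M hM hb
    refine key2 hd hp F hF hFc (cConst d) (fun y => y j * y k) (by fun_prop) ?_ ?_
      (LinearIsometryEquiv.piLpCongrRight 2 (fun i => if i = j then LinearIsometryEquiv.neg ℝ
        else LinearIsometryEquiv.refl ℝ ℝ))
      (Equiv.piCongrRight (fun i => if i = j then Equiv.neg ℤ else Equiv.refl ℤ)) ?_ ?_ hM ?_
    · intro y
      rw [abs_mul]
      have h1 := abs_coord y j
      have h2 := abs_coord y k
      nlinarith [mul_le_mul h1 h2 (abs_nonneg _) (norm_nonneg _), sq_nonneg ‖y‖]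
    · intro h y
      simp only [PiLp.smul_apply, smul_eq_mul]; ring
    · intro m
      ext i
      by_cases hi : i = j <;> simp [latVec_apply, hi]
    · intro y
      simp [hjk.symm]
    · intro f hf
      have := hb f (memLat_of_finite hp f hf)
      simp only [← discK_eq]
      exact this
  · intro M hM hb
    refine key2 hd hp F hF hFc (cConst d) (fun y => y j ^ 2 - y k ^ 2) (by fun_prop) ?_ ?_
      (LinearIsometryEquiv.piLpCongrLeft 2 ℝ ℝ (Equiv.swap j k))
      (Equiv.piCongrLeft' (fun _ => ℤ) (Equiv.swap j k)) ?_ ?_ hM ?_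
    · intro y
      have h1 := sq_le_sq.mpr ((abs_coord y j).trans (le_abs_self _))
      have h2 := sq_le_sq.mpr ((abs_coord y k).trans (le_abs_self _))
      rw [abs_le]
      constructor <;> nlinarith [sq_nonneg (y j), sq_nonneg (y k)]
    · intro h y
      simp only [PiLp.smul_apply, smul_eq_mul]; ring
    · intro m
      ext i
      simp [latVec_apply, LinearIsometryEquiv.piLpCongrLeft_apply]
    · intro y
      simp [LinearIsometryEquiv.piLpCongrLeft_apply]
    · intro f hf
      have := hb f (memLat_of_finite hp f hf)
      have e : ∀ n, Rdis d j j f n - Rdis d k k f n = ∑' m : ZLat d,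
          cConst d * ((latVec m j ^ 2 - latVec m k ^ 2) / ‖latVec m‖ ^ (d + 2)) * f (n - m) := by
        intro n
        unfold Rdis
        rw [← (summable_fin _ f hf n).tsum_sub (summable_fin _ f hf n)]
        refine tsum_congr fun m => ?_
        rw [discK_eq, discK_eq]; ring
      simp only [e] at this
      exact this

end
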